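/- Let S = {x ∈ ℝⁿ : g₁(x) ≥ 0, …, g_m(x) ≥ 0} and suppose Assumption A holds. Then for every fixed ε > 0 and r > 0 with closure(conv(S)) ∩ 𝐁_r ≠ ∅, there exists an integer k_{r,ε} ∈ ℕ such that closure(conv(S)) ∩ 𝐁_r ⊆ TH̃_{k_{r,ε}}(G̃) ∩ 𝐁_r ⊆ (closure(conv(S)) + ε𝐁₁) ∩ 𝐁_r. -/

import Mathlib

open MvPolynomial Pointwise

/-- Homogenization of a polynomial in variables `X₁,…,Xₙ` (indexed by `Fin n`, shifted to
`X₁,…,Xₙ` via `Fin.succ`) with a new homogenizing variable `X₀`. -/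
noncomputable def homog {n : ℕ} (f : MvPolynomial (Fin n) ℝ) : MvPolynomial (Fin (n + 1)) ℝ :=
  ∑ α ∈ f.support,
    MvPolynomial.monomial
      (Finsupp.mapDomain Fin.succ α + Finsupp.single 0 (f.totalDegree - α.sum fun _ e => e))
      (MvPolynomial.coeff α f)

/-- The `k`-th truncated quadratic module generated by the family `g`. -/
def QMod {τ ι : Type*} [Fintype ι] (k : ℕ) (g : ι → MvPolynomial τ ℝ) :
    Set (MvPolynomial τ ℝ) :=
  {p | ∃ s₀ : MvPolynomial τ ℝ, ∃ s : ι → MvPolynomial τ ℝ,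
      IsSumSq s₀ ∧ s₀.totalDegree ≤ 2 * k ∧
      (∀ i, IsSumSq (s i) ∧ (s i * g i).totalDegree ≤ 2 * k) ∧
      p = s₀ + ∑ i, s i * g i}

/-- The homogenized generating family `G̃`. -/
noncomputable def tGens {n : ℕ} {ι : Type*} (g : ι → MvPolynomial (Fin n) ℝ) :
    ι ⊕ Fin 3 → MvPolynomial (Fin (n + 1)) ℝ :=
  Sum.elim (fun j => homog (g j))
    ![X 0, (∑ i, X i ^ 2) - 1, 1 - ∑ i, X i ^ 2]

/-- The modified theta body `TH̃ₖ(G̃)`. -/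
noncomputable def thetaB {n : ℕ} {ι : Type*} [Fintype ι] (k : ℕ)
    (g : ι → MvPolynomial (Fin n) ℝ) : Set (Fin n → ℝ) :=
  {x | ∀ l ∈ QMod k (tGens g), l.IsHomogeneous 1 → 0 ≤ eval (Fin.cons 1 x) l}

/-- The Riesz functional of a truncated moment sequence. -/
noncomputable def riesz {m : ℕ} (y : (Fin m →₀ ℕ) → ℝ) (p : MvPolynomial (Fin m) ℝ) : ℝ :=
  ∑ α ∈ p.support, MvPolynomial.coeff α p * y α

/-- The moment relaxation `Ωₖ(G̃)`. -/
noncomputable def omegaRel {n : ℕ} {ι : Type*} [Fintype ι] (k : ℕ)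
    (g : ι → MvPolynomial (Fin n) ℝ) : Set (Fin n → ℝ) :=
  {x | ∃ y : (Fin (n + 1) →₀ ℕ) → ℝ,
      riesz y (X 0) = 1 ∧
      (∀ i : Fin n, riesz y (X i.succ) = x i) ∧
      (∀ q : MvPolynomial (Fin (n + 1)) ℝ, q.totalDegree ≤ k → 0 ≤ riesz y (q ^ 2)) ∧
      (∀ q : MvPolynomial (Fin (n + 1)) ℝ, q.totalDegree ≤ k - 1 → 0 ≤ riesz y (X 0 * q ^ 2)) ∧
      (∀ q : MvPolynomial (Fin (n + 1)) ℝ, q.totalDegree ≤ 2 * (k - 1) →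
        riesz y (((∑ i, X i ^ 2) - 1) * q) = 0) ∧
      (∀ j : ι, ∀ q : MvPolynomial (Fin (n + 1)) ℝ,
        q.totalDegree ≤ k - ((g j).totalDegree + 1) / 2 → 0 ≤ riesz y (homog (g j) * q ^ 2))}

/-- The basic semialgebraic set defined by the family `g`. -/
def semiS {n : ℕ} {ι : Type*} (g : ι → MvPolynomial (Fin n) ℝ) : Set (Fin n → ℝ) :=
  {x | ∀ j, 0 ≤ eval x (g j)}

/-- `S̃ᵒ`. -/
noncomputable def StO {n : ℕ} {ι : Type*} (g : ι → MvPolynomial (Fin n) ℝ) :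
    Set (Fin (n + 1) → ℝ) :=
  {x | (∀ j, 0 ≤ eval x (homog (g j))) ∧ 0 < x 0}

/-- `S̃ᶜ`. -/
noncomputable def StC {n : ℕ} {ι : Type*} (g : ι → MvPolynomial (Fin n) ℝ) :
    Set (Fin (n + 1) → ℝ) :=
  {x | (∀ j, 0 ≤ eval x (homog (g j))) ∧ 0 ≤ x 0}

/-- `S̃ = S̃ᶜ ∩ {‖x̃‖₂ = 1}`. -/
noncomputable def StS {n : ℕ} {ι : Type*} (g : ι → MvPolynomial (Fin n) ℝ) :
    Set (Fin (n + 1) → ℝ) :=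
  {x | (∀ j, 0 ≤ eval x (homog (g j))) ∧ 0 ≤ x 0 ∧ ∑ i, x i ^ 2 = 1}

/-- Assumption A: `S` is closed at infinity, and `conv(closure(S̃ᵒ))` is closed and pointed. -/
noncomputable def AssumpA {n : ℕ} {ι : Type*} (g : ι → MvPolynomial (Fin n) ℝ) : Prop :=
  closure (StO g) = StC g ∧ IsClosed (convexHull ℝ (closure (StO g))) ∧
    convexHull ℝ (closure (StO g)) ∩ -(convexHull ℝ (closure (StO g))) = {0}

/-- The PP-BDR property with order `k` for the set `T ⊆ ℝⁿ⁺¹` relative to the homogenized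
generating family `tGens g`: outside a Lebesgue-null set of coefficient vectors, every affine
polynomial positive on `T` lies in the `k`-th truncated quadratic module of `G̃`. -/
noncomputable def ppBDR {n : ℕ} {ι : Type*} [Fintype ι] (k : ℕ)
    (g : ι → MvPolynomial (Fin n) ℝ) (T : Set (Fin (n + 1) → ℝ)) : Prop :=
  MeasureTheory.volume {c : Fin (n + 2) → ℝ |
    (∀ x ∈ T, 0 < c 0 + ∑ i : Fin (n + 1), c i.succ * x i) ∧
    (C (c 0) + ∑ i : Fin (n + 1), C (c i.succ) * X i) ∉ QMod k (tGens g)} = 0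


/-- Representation theorem for archimedean quadratic modules: states. -/
def IsState {A : Type*} [CommRing A] [Algebra ℝ A] (M : Set A) (F : A → ℝ) : Prop :=
  (∀ p q, F (p + q) = F p + F q) ∧ (∀ (c : ℝ) p, F (c • p) = c * F p) ∧
    (∀ p ∈ M, 0 ≤ F p) ∧ F 1 = 1

structure IsArchQM {A : Type*} [CommRing A] [Algebra ℝ A] (M : Set A) : Prop where
  add : ∀ p ∈ M, ∀ q ∈ M, p + q ∈ M
  sq : ∀ h, ∀ p ∈ M, h * h * p ∈ M
  one : (1 : A) ∈ M
  arch : ∀ p, ∃ N : ℝ, 1 ≤ N ∧ N • (1 : A) - p ∈ M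

section
variable {A : Type*} [CommRing A] [Algebra ℝ A] {M : Set A}

theorem IsArchQM.smul (hM : IsArchQM M) (c : ℝ) (hc : 0 ≤ c) (p : A) (hp : p ∈ M) :
    c • p ∈ M := by
  have := hM.sq (Real.sqrt c • (1 : A)) p hp
  rwa [smul_mul_smul_comm, Real.mul_self_sqrt hc, one_mul, smul_one_mul] at this

theorem IsState.sub {F : A → ℝ} (hF : IsState M F) (p q : A) : F (p - q) = F p - F q := by
  have := hF.1 (p - q) q
  rw [sub_add_cancel] at this
  linarith

theorem IsArchQM.one_sub_pow (hM : IsArchQM M) (h : A) (hh : 1 - h * h ∈ M) (j : ℕ) :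
    1 - (h * h) ^ (j + 1) ∈ M := by
  induction j with
  | zero => simpa using hh
  | succ j ih =>
    have := hM.add _ hh _ (hM.sq h _ ih)
    convert this using 1
    ring

theorem IsState.mul_le (hM : IsArchQM M) {F : A → ℝ} (hF : IsState M F) (h : A)
    (hh : 1 - h * h ∈ M) (q : A) (hq : q ∈ M) : F (h * h * q) ≤ F q := by
  by_contra! hlt
  obtain ⟨N, hN, hNq⟩ := hM.arch q
  have hb : ∀ k : ℕ, F ((h * h) ^ (2 ^ k) * q) ≤ N := by
    intro k
    have hpos : 0 < 2 ^ k := by positivity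
    obtain ⟨j, hj⟩ : ∃ j, 2 ^ k = j + 1 := ⟨2 ^ k - 1, by omega⟩
    have h1 := hF.2.2.1 _ (hM.sq (h ^ (2 ^ k)) _ hNq)
    have h2 := hF.2.2.1 _ (hM.one_sub_pow h hh j)
    rw [← hj, hF.sub, hF.2.2.2] at h2
    have e : h ^ 2 ^ k * h ^ 2 ^ k * (N • (1:A) - q) = N • ((h * h) ^ 2 ^ k) - (h * h) ^ 2 ^ k * q := by
      rw [mul_sub, mul_smul_comm, mul_one, mul_pow]
    rw [e, hF.sub, hF.2.1] at h1
    nlinarith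
  have hg : ∀ k : ℕ, 2 ^ k * (F (h * h * q) - F q) ≤ F ((h * h) ^ (2 ^ k) * q) - F q := by
    intro k
    induction k with
    | zero => simp
    | succ k ih =>
      have h1 := hF.2.2.1 _ (hM.sq ((h * h) ^ (2 ^ k) - 1) _ hq)
      have e : ((h * h) ^ 2 ^ k - 1) * ((h * h) ^ 2 ^ k - 1) * q
        = (h * h) ^ 2 ^ (k+1) * q - ((h * h) ^ 2 ^ k * q + (h * h) ^ 2 ^ k * q) + q := by
        rw [pow_succ 2 k, pow_mul]; ring
      rw [e, hF.1, hF.sub, hF.1] at h1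
      rw [pow_succ]
      linarith
  have hd : 0 < F (h * h * q) - F q := by linarith
  obtain ⟨k, hk⟩ := pow_unbounded_of_one_lt ((N - F q) / (F (h * h * q) - F q)) (one_lt_two)
  rw [div_lt_iff₀ hd] at hk
  linarith [hb k, hg k]

theorem IsState.mul_of_extreme_aux (hM : IsArchQM M) {F : A → ℝ} (hF : IsState M F)
    (hext : ∀ F₁ F₂ : A → ℝ, IsState M F₁ → IsState M F₂ → ∀ a b : ℝ, 0 < a → 0 < b → a + b = 1 →
      (∀ p, F p = a * F₁ p + b * F₂ p) → F₁ = F) (h : A)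
    (hh : (1 / 2 : ℝ) • (1 : A) - h * h ∈ M) (q : A) : F (h * h * q) = F (h * h) * F q := by
  have hh1 : 1 - h * h ∈ M := by
    have := hM.add _ hh _ (hM.smul (1/2) (by norm_num) _ hM.one)
    convert this using 1
    module
  have hlt : F (h * h) ≤ 1 / 2 := by
    have := hF.2.2.1 _ hh
    rw [hF.sub, hF.2.1, hF.2.2.2] at this
    linarith
  have h0 : 0 ≤ F (h * h) := by
    have := hF.2.2.1 _ (hM.sq h _ hM.one)
    rwa [mul_one] at this
  rcases h0.eq_or_lt with h0 | h0
  · rw [← h0, zero_mul]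
    have key : ∀ q ∈ M, F (h * h * q) = 0 := by
      intro q hq
      obtain ⟨N, hN, hNq⟩ := hM.arch q
      have h1 := hF.2.2.1 _ (hM.sq h _ hNq)
      have h2 := hF.2.2.1 _ (hM.sq h _ hq)
      rw [mul_sub, mul_smul_comm, mul_one, hF.sub, hF.2.1, ← h0] at h1
      linarith
    obtain ⟨N, hN, hNq⟩ := hM.arch q
    have h1 := key _ hNq
    rw [mul_sub, mul_smul_comm, mul_one, hF.sub, hF.2.1, ← h0] at h1
    linarith
  · set l := F (h * h) with hl
    have hl1 : 0 < 1 - l := by linarith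
    have := hext (fun q => F (h * h * q) / l) (fun q => (F q - F (h * h * q)) / (1 - l))
      ⟨fun p q => by simp only [mul_add, hF.1]; ring,
       fun c p => by simp only [mul_smul_comm, hF.2.1]; ring,
       fun p hp => div_nonneg (hF.2.2.1 _ (hM.sq h _ hp)) h0.le,
       by simp only [mul_one]; exact div_self h0.ne'⟩
      ⟨fun p q => by simp only [mul_add, hF.1]; ring,
       fun c p => by simp only [mul_smul_comm, hF.2.1]; ring,
       fun p hp => div_nonneg (by linarith [hF.mul_le hM h hh1 p hp]) hl1.le,
       by simp only [mul_one, hF.2.2.2]; exact div_self hl1.ne'⟩ l (1 - l) h0 hl1 (by ring)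
      (fun p => by field_simp; ring)
    have := congrFun this q
    have this : F (h * h * q) / l = F q := this
    rw [div_eq_iff h0.ne'] at this
    linarith

theorem IsState.mul_of_extreme (hM : IsArchQM M) {F : A → ℝ} (hF : IsState M F)
    (hext : ∀ F₁ F₂ : A → ℝ, IsState M F₁ → IsState M F₂ → ∀ a b : ℝ, 0 < a → 0 < b → a + b = 1 →
      (∀ p, F p = a * F₁ p + b * F₂ p) → F₁ = F) (p q : A) : F (p * q) = F p * F q := by
  have key : ∀ h q : A, F (h * h * q) = F (h * h) * F q := by
    intro h q
    obtain ⟨N, hN, hNq⟩ := hM.arch (h * h)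
    have hc : Real.sqrt (1 / (2 * N)) * Real.sqrt (1 / (2 * N)) = 1 / (2 * N) :=
      Real.mul_self_sqrt (by positivity)
    have := hF.mul_of_extreme_aux hM hext (Real.sqrt (1 / (2 * N)) • h) (by
      have := hM.smul (1 / (2 * N)) (by positivity) _ hNq
      rw [smul_mul_smul_comm, hc]
      rw [smul_sub, smul_smul] at this
      convert this using 3
      field_simp) q
    rw [smul_mul_smul_comm, hc, smul_mul_assoc, hF.2.1, hF.2.1, mul_assoc (1 / (2 * N))] at this
    exact mul_left_cancel₀ (by positivity) this
  have h1 := key (p + 1) q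
  have h2 := key (p - 1) q
  have e1 : (p + 1) * (p + 1) * q = (p * p * q + q) + (p * q + p * q) := by ring
  have e2 : (p - 1) * (p - 1) * q = (p * p * q + q) - (p * q + p * q) := by ring
  have e3 : (p + 1) * (p + 1) = (p * p + 1) + (p + p) := by ring
  have e4 : (p - 1) * (p - 1) = (p * p + 1) - (p + p) := by ring
  rw [e1, e3] at h1
  rw [e2, e4] at h2
  simp only [hF.1, hF.sub, key p q] at h1 h2
  linarith

theorem IsArchQM.exists_state (hM : IsArchQM M) (f : A) (hf : f ∉ M) :
    ∃ F : A → ℝ, IsState M F ∧ F f ≤ 0 := by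
  have hneg : (-1 : A) ∉ M := by
    intro h
    obtain ⟨N, hN, hNq⟩ := hM.arch (-f)
    apply hf
    have := hM.add _ hNq _ (hM.smul N (by linarith) _ h)
    convert this using 1
    module
  have h0 : (0 : A) ∈ M := by simpa using hM.smul 0 le_rfl _ hM.one
  let K : PointedCone ℝ A :=
    { carrier := {p | ∃ q ∈ M, ∃ t : ℝ, 0 ≤ t ∧ p = q - t • f}
      zero_mem' := ⟨0, h0, 0, le_rfl, by simp⟩
      smul_mem' := by
        intro c p hp
        obtain ⟨c, hc⟩ := c
        obtain ⟨q, hq, t, ht, rfl⟩ := hp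
        refine ⟨c • q, hM.smul c hc _ hq, c * t, by positivity, ?_⟩
        change c • (q - t • f) = _
        module
      add_mem' := by
        rintro _ _ ⟨q, hq, t, ht, rfl⟩ ⟨q', hq', t', ht', rfl⟩
        exact ⟨q + q', hM.add _ hq _ hq', t + t', by positivity, by module⟩ }
  have hK1 : (-1 : A) ∉ K := by
    rintro ⟨q, hq, t, ht, e⟩
    rcases ht.eq_or_lt with rfl | ht
    · apply hneg; rw [e]; simpa using hq
    · apply hf
      have := hM.smul t⁻¹ (by positivity) _ (hM.add _ hM.one _ hq)
      convert this using 1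
      have : (1 : A) + q = t • f := by linear_combination -e
      rw [this, smul_smul, inv_mul_cancel₀ ht.ne', one_smul]
  have h1 : (1 : A) ≠ 0 := by
    intro h
    apply hneg
    rw [h, neg_zero]; exact h0
  let φ : A →ₗ.[ℝ] ℝ := LinearPMap.mkSpanSingleton (1 : A) (1 : ℝ) h1
  have hφ : ∀ (c : ℝ) (hc), φ ⟨c • 1, hc⟩ = c := by
    intro c hc
    refine (LinearPMap.mkSpanSingleton'_apply _ _ _ c hc).trans (by simp)
  obtain ⟨L, hL1, hL2⟩ := riesz_extension K φ (by
    rintro ⟨x, hx⟩ hxK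
    obtain ⟨c, rfl⟩ := Submodule.mem_span_singleton.1 hx
    rw [hφ]
    by_contra! hc
    apply hK1
    have := PointedCone.smul_mem K (show 0 ≤ (-c)⁻¹ by simpa using hc.le) hxK
    change (-c)⁻¹ • (c • (1:A)) ∈ K at this
    rw [show ((-c)⁻¹ • (c • (1:A))) = -1 by
      rw [smul_smul, inv_neg, neg_mul, inv_mul_cancel₀ hc.ne, neg_one_smul]] at this
    exact this) (by
    intro y
    obtain ⟨N, hN, hNq⟩ := hM.arch (-y)
    refine ⟨⟨N • 1, Submodule.mem_span_singleton.2 ⟨N, rfl⟩⟩, N • 1 - (-y), hNq, 0, le_rfl, ?_⟩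
    simp)
  refine ⟨L, ⟨map_add L, fun c p => by simp, fun p hp => hL2 _ ⟨p, hp, 0, le_rfl, by simp⟩, ?_⟩, ?_⟩
  · have := hL1 ⟨(1:ℝ) • 1, Submodule.mem_span_singleton.2 ⟨1, rfl⟩⟩
    have h2 := this.trans (hφ 1 _)
    simpa using h2
  · have := hL2 (-f) ⟨0, h0, 1, zero_le_one, by simp⟩
    rw [map_neg] at this
    linarith

theorem IsArchQM.exists_hom (hM : IsArchQM M) (f : A) (hf : f ∉ M) :
    ∃ φ : A →ₐ[ℝ] ℝ, (∀ p ∈ M, 0 ≤ φ p) ∧ φ f ≤ 0 := by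
  obtain ⟨F₀, hF₀, hF₀f⟩ := hM.exists_state f hf
  let K : Set (A → ℝ) := {F | IsState M F}
  choose N hN1 hN using hM.arch
  have hKc : IsClosed K := by
    have : K = (⋂ p, ⋂ q, {F | F (p + q) = F p + F q}) ∩ ((⋂ (c : ℝ), ⋂ p, {F | F (c • p) = c * F p}) ∩
      ((⋂ p ∈ M, {F | 0 ≤ F p}) ∩ {F | F 1 = 1})) := by
      ext F; simp [K, IsState]
    rw [this]
    refine IsClosed.inter (isClosed_iInter fun p => isClosed_iInter fun q => isClosed_eq (by fun_prop) (by fun_prop)) (IsClosed.inter (isClosed_iInter fun c => isClosed_iInter fun q => isClosed_eq (by fun_prop) (by fun_prop)) (IsClosed.inter (isClosed_iInter fun c => isClosed_iInter fun q => isClosed_le (by fun_prop) (by fun_prop)) (isClosed_eq (by fun_prop) (by fun_prop))))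
  have hKcomp : IsCompact K := by
    refine (isCompact_univ_pi (fun p : A => isCompact_Icc (a := -N (-p)) (b := N p))).of_isClosed_subset hKc ?_
    intro F hF p _
    have h1 := hF.2.2.1 _ (hN p)
    have h2 := hF.2.2.1 _ (hN (-p))
    rw [IsState.sub hF, hF.2.1, hF.2.2.2] at h1 h2
    have h3 : F (-p) = - F p := by
      have := hF.2.1 (-1) p
      simpa using this
    constructor <;> linarith
  obtain ⟨F₁, hF₁, hmin⟩ := hKcomp.exists_isMinOn ⟨F₀, hF₀⟩ (f := fun F => F f) (by fun_prop)
  let K' : Set (A → ℝ) := K ∩ {F | F f = F₁ f}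
  have hK' : IsCompact K' := hKcomp.inter_right (isClosed_eq (by fun_prop) (by fun_prop))
  obtain ⟨F, hFK, hFe⟩ := hK'.extremePoints_nonempty ⟨F₁, hF₁, rfl⟩
  have hF : IsState M F := hFK.1
  have hext : ∀ F₁ F₂ : A → ℝ, IsState M F₁ → IsState M F₂ → ∀ a b : ℝ, 0 < a → 0 < b → a + b = 1 →
      (∀ p, F p = a * F₁ p + b * F₂ p) → F₁ = F := by
    intro G H hG hH a b ha hb hab e
    have hg := hmin (show G ∈ K from hG)
    have hh := hmin (show H ∈ K from hH)
    simp only [Set.mem_ofPred_eq] at hg hh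
    have e1 := e f
    have e2 : F f = F₁ f := hFK.2
    have hb' : b = 1 - a := by linarith
    subst hb'
    have hG' : G f = F₁ f := by nlinarith
    have hH' : H f = F₁ f := by nlinarith
    refine hFe ⟨hG, hG'⟩ ⟨hH, hH'⟩ ⟨a, 1 - a, ha, hb, hab, ?_⟩
    funext p
    simp [e p]
  refine ⟨AlgHom.ofLinearMap ⟨⟨F, hF.1⟩, fun c p => by simpa using hF.2.1 c p⟩ hF.2.2.2
    (hF.mul_of_extreme hM hext), hF.2.2.1, ?_⟩
  change F f ≤ 0
  rw [show F f = F₁ f from hFK.2]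
  exact (hmin (show F₀ ∈ K from hF₀)).trans hF₀f

end

section partB

/-- The (untruncated) quadratic module. -/
def QFull {τ ι : Type*} [Fintype ι] (g : ι → MvPolynomial τ ℝ) : Set (MvPolynomial τ ℝ) :=
  {p | ∃ s₀ : MvPolynomial τ ℝ, ∃ s : ι → MvPolynomial τ ℝ,
      IsSumSq s₀ ∧ (∀ i, IsSumSq (s i)) ∧ p = s₀ + ∑ i, s i * g i}

theorem QFull_QMod {τ ι : Type*} [Fintype ι] (g : ι → MvPolynomial τ ℝ) (p : MvPolynomial τ ℝ)
    (hp : p ∈ QFull g) : ∃ k, p ∈ QMod k g := by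
  obtain ⟨s₀, s, h0, h, rfl⟩ := hp
  refine ⟨s₀.totalDegree + ∑ i, (s i * g i).totalDegree, s₀, s, h0, by omega, fun i => ⟨h i, ?_⟩, rfl⟩
  have := Finset.single_le_sum (f := fun i => (s i * g i).totalDegree) (fun _ _ => Nat.zero_le _) (Finset.mem_univ i)
  omega

theorem QMod_mono {τ ι : Type*} [Fintype ι] (g : ι → MvPolynomial τ ℝ) {k l : ℕ} (hkl : k ≤ l) :
    QMod k g ⊆ QMod l g := by
  rintro p ⟨s₀, s, h0, h0', h, rfl⟩
  exact ⟨s₀, s, h0, by omega, fun i => ⟨(h i).1, (h i).2.trans (by omega)⟩, rfl⟩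

theorem isSumSq_eval_nonneg {τ : Type*} (x : τ → ℝ) (s : MvPolynomial τ ℝ) (hs : IsSumSq s) :
    0 ≤ eval x s := by
  induction hs with
  | zero => simp
  | sq_add a hs ih =>
    rw [map_add, map_mul]
    nlinarith [mul_self_nonneg (eval x a)]

theorem QMod_eval_nonneg {τ ι : Type*} [Fintype ι] (g : ι → MvPolynomial τ ℝ) (k : ℕ) (x : τ → ℝ)
    (hx : ∀ i, 0 ≤ eval x (g i)) (p : MvPolynomial τ ℝ) (hp : p ∈ QMod k g) : 0 ≤ eval x p := by
  obtain ⟨s₀, s, h0, h0', h, rfl⟩ := hp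
  rw [map_add, map_sum]
  refine add_nonneg (isSumSq_eval_nonneg x _ h0) (Finset.sum_nonneg fun i _ => ?_)
  rw [map_mul]
  exact mul_nonneg (isSumSq_eval_nonneg x _ (h i).1) (hx i)

section
variable {τ ι : Type*} [Fintype ι] (g : ι → MvPolynomial τ ℝ)

theorem QFull_add (p q : MvPolynomial τ ℝ) (hp : p ∈ QFull g) (hq : q ∈ QFull g) : p + q ∈ QFull g := by
  obtain ⟨s₀, s, h0, h, rfl⟩ := hp
  obtain ⟨t₀, t, k0, k, rfl⟩ := hq
  refine ⟨s₀ + t₀, fun i => s i + t i, h0.add k0, fun i => (h i).add (k i), ?_⟩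
  simp only [add_mul, Finset.sum_add_distrib]
  ring

theorem QFull_sq (h p : MvPolynomial τ ℝ) (hp : p ∈ QFull g) : h * h * p ∈ QFull g := by
  obtain ⟨s₀, s, h0, hs, rfl⟩ := hp
  refine ⟨h * h * s₀, fun i => h * h * s i, (IsSumSq.mul_self h).mul h0,
    fun i => (IsSumSq.mul_self h).mul (hs i), ?_⟩
  simp only [mul_add, Finset.mul_sum, mul_assoc]

theorem QFull_sos (p : MvPolynomial τ ℝ) (hp : IsSumSq p) : p ∈ QFull g :=
  ⟨p, fun _ => 0, hp, fun _ => IsSumSq.zero, by simp⟩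

theorem QFull_gen (i : ι) : g i ∈ QFull g := by
  classical
  refine ⟨0, fun j => if j = i then 1 else 0, IsSumSq.zero, fun j => ?_, by simp⟩
  dsimp only
  split_ifs
  · exact IsSumSq.one
  · exact IsSumSq.zero

theorem QFull_smul (c : ℝ) (hc : 0 ≤ c) (p : MvPolynomial τ ℝ) (hp : p ∈ QFull g) : c • p ∈ QFull g := by
  have := QFull_sq g (Real.sqrt c • 1) p hp
  rwa [smul_mul_smul_comm, Real.mul_self_sqrt hc, one_mul, smul_one_mul] at this

/-- Bounded elements. -/
def Bdd (p : MvPolynomial τ ℝ) : Prop :=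
  ∃ N : ℝ, 1 ≤ N ∧ N • 1 - p ∈ QFull g ∧ N • 1 + p ∈ QFull g

variable {g}

theorem Bdd.add {p q : MvPolynomial τ ℝ} (hp : Bdd g p) (hq : Bdd g q) : Bdd g (p + q) := by
  obtain ⟨N, hN, h1, h2⟩ := hp
  obtain ⟨N', hN', h1', h2'⟩ := hq
  refine ⟨N + N', by linarith, ?_, ?_⟩
  · convert QFull_add g _ _ h1 h1' using 1; module
  · convert QFull_add g _ _ h2 h2' using 1; module

theorem Bdd.neg {p : MvPolynomial τ ℝ} (hp : Bdd g p) : Bdd g (-p) := by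
  obtain ⟨N, hN, h1, h2⟩ := hp
  exact ⟨N, hN, by simpa using h2, by simpa [sub_eq_add_neg] using h1⟩

theorem Bdd.smul_nonneg {p : MvPolynomial τ ℝ} (hp : Bdd g p) (c : ℝ) (hc : 0 ≤ c) : Bdd g (c • p) := by
  obtain ⟨N, hN, h1, h2⟩ := hp
  have one := QFull_sos g 1 IsSumSq.one
  refine ⟨c * N + 1, by nlinarith, ?_, ?_⟩
  · convert QFull_add g _ _ one (QFull_smul g c hc _ h1) using 1; module
  · convert QFull_add g _ _ one (QFull_smul g c hc _ h2) using 1; module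

theorem Bdd.mul_self {p : MvPolynomial τ ℝ} (hp : Bdd g p) : Bdd g (p * p) := by
  obtain ⟨N, hN, h1, h2⟩ := hp
  refine ⟨N * N, by nlinarith, ?_, ?_⟩
  · have := QFull_smul g (1 / (2 * N)) (by positivity) _
      (QFull_add g _ _ (QFull_sq g (N • 1 + p) _ h1) (QFull_sq g (N • 1 - p) _ h2))
    convert this using 1
    have e : (N • 1 + p) * (N • 1 + p) * (N • 1 - p) + (N • 1 - p) * (N • 1 - p) * (N • 1 + p)
      = (2 * N) • ((N * N) • 1 - p * p) := by
      simp only [smul_eq_C_mul, map_mul, map_ofNat]; ring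
    rw [e, smul_smul, one_div, inv_mul_cancel₀ (by positivity), one_smul]
  · exact QFull_add g _ _ (QFull_smul g _ (by positivity) _ (QFull_sos g 1 IsSumSq.one))
      (QFull_sos g _ (IsSumSq.mul_self p))

theorem Bdd.mul {p q : MvPolynomial τ ℝ} (hp : Bdd g p) (hq : Bdd g q) : Bdd g (p * q) := by
  have := ((hp.add hq).mul_self.add (hp.add hq.neg).mul_self.neg).smul_nonneg (1 / 4) (by norm_num)
  convert this using 1
  have e : (p + q) * (p + q) + -((p + -q) * (p + -q)) = (4 : ℝ) • (p * q) := by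
    simp only [smul_eq_C_mul, map_ofNat]; ring
  rw [e, smul_smul]; norm_num

theorem Bdd.C (c : ℝ) : Bdd g (MvPolynomial.C c) := by
  have one := QFull_sos g 1 IsSumSq.one
  have e : MvPolynomial.C (σ := τ) c = c • 1 := by rw [smul_eq_C_mul, mul_one]
  refine ⟨|c| + 1, by linarith [abs_nonneg c], ?_, ?_⟩
  · rw [e, ← sub_smul]
    exact QFull_smul g _ (by linarith [le_abs_self c]) _ one
  · rw [e, ← add_smul]
    exact QFull_smul g _ (by linarith [neg_abs_le c]) _ one

theorem Bdd.all (hX : ∀ i, Bdd g (X i)) (p : MvPolynomial τ ℝ) : Bdd g p := by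
  induction p using MvPolynomial.induction_on with
  | C a => exact Bdd.C a
  | add p q hp hq => exact hp.add hq
  | mul_X p i hp => exact hp.mul (hX i)

theorem QFull_arch [Fintype τ] (h : 1 - ∑ i, X i ^ 2 ∈ QFull g) : IsArchQM (QFull g) where
  add p hp q hq := QFull_add g p q hp hq
  sq h p hp := QFull_sq g h p hp
  one := QFull_sos g 1 IsSumSq.one
  arch p := by
    classical
    suffices hX : ∀ i, Bdd g (X i) by
      obtain ⟨N, hN, h1, -⟩ := Bdd.all hX p
      exact ⟨N, hN, h1⟩
    intro i
    have h2 : 1 - X i ^ 2 ∈ QFull g := by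
      have := QFull_add g _ _ h (QFull_sos g (∑ j ∈ Finset.univ.erase i, X j ^ 2) (IsSumSq.sum_sq _ _))
      convert this using 1
      rw [← Finset.add_sum_erase _ _ (Finset.mem_univ i)]
      ring
    refine ⟨1, le_rfl, ?_, ?_⟩
    · have := QFull_smul g (1/2) (by norm_num) _ (QFull_add g _ _ h2 (QFull_sos g _ (IsSumSq.mul_self (1 - X i))))
      convert this using 1
      have e : 1 - X i ^ 2 + (1 - X i) * (1 - X i) = (2 : ℝ) • ((1 : ℝ) • 1 - X i : MvPolynomial τ ℝ) := by
        simp only [smul_eq_C_mul, map_ofNat, map_one]; ring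
      rw [e, smul_smul]; norm_num
    · have := QFull_smul g (1/2) (by norm_num) _ (QFull_add g _ _ h2 (QFull_sos g _ (IsSumSq.mul_self (1 + X i))))
      convert this using 1
      have e : 1 - X i ^ 2 + (1 + X i) * (1 + X i) = (2 : ℝ) • ((1 : ℝ) • 1 + X i : MvPolynomial τ ℝ) := by
        simp only [smul_eq_C_mul, map_ofNat, map_one]; ring
      rw [e, smul_smul]; norm_num

/-- The Putinar Positivstellensatz. -/
theorem putinar [Fintype τ] (h : 1 - ∑ i, X i ^ 2 ∈ QFull g) (f : MvPolynomial τ ℝ)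
    (hf : ∀ x, (∀ i, 0 ≤ eval x (g i)) → 0 < eval x f) : f ∈ QFull g := by
  by_contra hn
  obtain ⟨φ, h1, h2⟩ := (QFull_arch h).exists_hom f hn
  have e : ∀ p, φ p = eval (fun i => φ (X i)) p := by
    intro p
    have : φ = aeval (fun i => φ (X i)) := by ext i; simp
    conv_lhs => rw [this]
    rfl
  have := hf (fun i => φ (X i)) (fun i => by rw [← e]; exact h1 _ (QFull_gen g i))
  rw [← e] at this
  linarith
end

theorem homog_isHomogeneous {n : ℕ} (f : MvPolynomial (Fin n) ℝ) :
    (homog f).IsHomogeneous f.totalDegree := by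
  refine IsHomogeneous.sum _ _ _ fun α hα => isHomogeneous_monomial _ ?_
  have h1 : (α.sum fun _ e => e) ≤ f.totalDegree := le_totalDegree hα
  have h2 : (Finsupp.mapDomain Fin.succ α).degree = α.sum fun _ e => e := by
    rw [Finsupp.degree_mapDomain]; rfl
  rw [map_add, h2, Finsupp.degree_single]
  omega

theorem eval_homog_cons {n : ℕ} (f : MvPolynomial (Fin n) ℝ) (x : Fin n → ℝ) :
    eval (Fin.cons 1 x : Fin (n + 1) → ℝ) (homog f) = eval x f := by
  rw [homog, map_sum]
  conv_rhs => rw [f.as_sum, map_sum]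
  refine Finset.sum_congr rfl fun α _ => ?_
  rw [eval_monomial, eval_monomial, Finsupp.prod_add_index' (by simp) (by intros; rw [pow_add]),
    Finsupp.prod_mapDomain_index (by simp) (by intros; rw [pow_add]), Finsupp.prod_single_index (by simp)]
  simp

theorem eval_smul_homog {k n : ℕ} {f : MvPolynomial (Fin n) ℝ} (hf : f.IsHomogeneous k) (c : ℝ)
    (x : Fin n → ℝ) : eval (c • x) f = c ^ k * eval x f := by
  rw [eval_eq, eval_eq, Finset.mul_sum]
  refine Finset.sum_congr rfl fun d hd => ?_
  have h := hf (mem_support_iff.1 hd)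
  simp only [Pi.smul_apply, smul_eq_mul, mul_pow, Finset.prod_mul_distrib]
  have : ∏ i ∈ d.support, c ^ d i = c ^ k := by
    rw [Finset.prod_pow_eq_pow_sum]
    congr 1
    rw [← h]
    simp [Finsupp.weight_apply, Finsupp.sum]
  rw [this]; ring
end partB

section partC
variable {n m : ℕ} (g : Fin m → MvPolynomial (Fin n) ℝ)

/-- The linear form of a functional. -/
noncomputable def linPoly (l : (Fin (n + 1) → ℝ) →ₗ[ℝ] ℝ) : MvPolynomial (Fin (n + 1)) ℝ :=
  ∑ i, C (l (Pi.single i 1)) * X i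

theorem linPoly_hom (l : (Fin (n + 1) → ℝ) →ₗ[ℝ] ℝ) : (linPoly l).IsHomogeneous 1 := by
  refine IsHomogeneous.sum _ _ _ fun i _ => ?_
  simpa using (isHomogeneous_C (Fin (n + 1)) (l (Pi.single i 1))).mul (isHomogeneous_X ℝ i)

theorem eval_linPoly (l : (Fin (n + 1) → ℝ) →ₗ[ℝ] ℝ) (x : Fin (n + 1) → ℝ) :
    eval x (linPoly l) = l x := by
  conv_rhs => rw [pi_eq_sum_univ' x, map_sum]
  rw [linPoly, map_sum]
  refine Finset.sum_congr rfl fun i _ => ?_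
  rw [map_smul, map_mul, eval_C, eval_X, smul_eq_mul, mul_comm]

theorem StC_smul {c : ℝ} (hc : 0 ≤ c) {x : Fin (n + 1) → ℝ} (hx : x ∈ StC g) : c • x ∈ StC g := by
  refine ⟨fun j => ?_, mul_nonneg hc hx.2⟩
  rw [eval_smul_homog (homog_isHomogeneous (g j))]
  exact mul_nonneg (pow_nonneg hc _) (hx.1 j)

theorem StS_of_StC {x : Fin (n + 1) → ℝ} (hx : x ∈ StC g) (h0 : x ≠ 0) :
    ∃ c : ℝ, 0 < c ∧ c • x ∈ StS g := by
  have hpos : 0 < ∑ i, x i ^ 2 := by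
    obtain ⟨i, hi⟩ := Function.ne_iff.1 h0
    exact Finset.sum_pos' (fun i _ => sq_nonneg _) ⟨i, Finset.mem_univ _, by
      have : x i ≠ 0 := hi
      positivity⟩
  refine ⟨(Real.sqrt (∑ i, x i ^ 2))⁻¹, by positivity, ?_⟩
  have := StC_smul g (c := (Real.sqrt (∑ i, x i ^ 2))⁻¹) (by positivity) hx
  refine ⟨this.1, this.2, ?_⟩
  simp only [Pi.smul_apply, smul_eq_mul, mul_pow, ← Finset.mul_sum]
  rw [inv_pow, Real.sq_sqrt hpos.le, inv_mul_cancel₀ hpos.ne']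

theorem StS_gens {x : Fin (n + 1) → ℝ} : x ∈ StS g ↔ ∀ i, 0 ≤ eval x (tGens g i) := by
  constructor
  · rintro ⟨h1, h2, h3⟩ (j | i)
    · exact h1 j
    · fin_cases i <;> simp [tGens, h2, h3]
  · intro h
    have h2 := h (Sum.inr 0)
    have h3 := h (Sum.inr 1)
    have h4 := h (Sum.inr 2)
    simp [tGens] at h2 h3 h4
    exact ⟨fun j => h (Sum.inl j), h2, by linarith⟩

theorem cons_mem_StC {x : Fin n → ℝ} (hx : x ∈ semiS g) : (Fin.cons 1 x : Fin (n + 1) → ℝ) ∈ StC g := by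
  refine ⟨fun j => ?_, by simp⟩
  rw [eval_homog_cons]
  exact hx j

theorem StO_cons {x : Fin (n + 1) → ℝ} (hx : x ∈ StO g) :
    ∃ z ∈ semiS g, x = x 0 • (Fin.cons 1 z : Fin (n + 1) → ℝ) := by
  have h0 := hx.2
  have e : x = x 0 • (Fin.cons 1 (fun i => x i.succ / x 0) : Fin (n + 1) → ℝ) := by
    ext i
    refine Fin.cases ?_ (fun i => ?_) i
    · simp
    · simp only [Pi.smul_apply, Fin.cons_succ, smul_eq_mul]
      field_simp
  refine ⟨_, fun j => ?_, e⟩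
  have := hx.1 j
  rw [e, eval_smul_homog (homog_isHomogeneous (g j)), eval_homog_cons] at this
  exact nonneg_of_mul_nonneg_right this (pow_pos h0 _)

theorem thetaB_sup (k : ℕ) : closure (convexHull ℝ (semiS g)) ⊆ thetaB k g := by
  have e : thetaB k g = ⋂ l ∈ {l | l ∈ QMod k (tGens g) ∧ l.IsHomogeneous 1},
      {x : Fin n → ℝ | 0 ≤ eval (Fin.cons 1 x) l} := by
    ext x; simp [thetaB]
  rw [e]
  refine Set.subset_iInter₂ fun l hl => ?_
  have hlin : ∀ (a b : ℝ) (x y : Fin n → ℝ), a + b = 1 → eval (Fin.cons 1 (a • x + b • y) : Fin (n + 1) → ℝ) l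
      = a * eval (Fin.cons 1 x : Fin (n + 1) → ℝ) l + b * eval (Fin.cons 1 y : Fin (n + 1) → ℝ) l := by
    intro a b x y hab
    have hv : (Fin.cons 1 (a • x + b • y) : Fin (n + 1) → ℝ) = a • (Fin.cons 1 x : Fin (n + 1) → ℝ) + b • (Fin.cons 1 y : Fin (n + 1) → ℝ) := by
      ext i
      refine Fin.cases ?_ (fun i => ?_) i <;> simp [hab]
    rw [hv]
    simp only [eval_eq, Finset.mul_sum, ← Finset.sum_add_distrib]
    refine Finset.sum_congr rfl fun d hd => ?_
    have h := hl.2 (mem_support_iff.1 hd)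
    obtain ⟨i, rfl⟩ : ∃ i, d = Finsupp.single i 1 := by
      rw [← Finsupp.sum_eq_one_iff]
      refine Eq.trans ?_ h
      simp [Finsupp.weight_apply, Finsupp.sum]
    rw [Finsupp.support_single_ne_zero _ one_ne_zero]
    simp
    ring
  refine closure_minimal (convexHull_min ?_ ?_) ?_
  · intro x hx
    have hx' := cons_mem_StC g hx
    obtain ⟨c, hc, hcS⟩ := StS_of_StC g hx' (fun h => by simpa using congrFun h 0)
    have := QMod_eval_nonneg _ k _ ((StS_gens g).1 hcS) l hl.1
    rw [eval_smul_homog hl.2, pow_one] at this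
    exact nonneg_of_mul_nonneg_right this hc
  · intro x hx y hy a b ha hb hab
    change 0 ≤ eval (Fin.cons 1 (a • x + b • y) : Fin (n + 1) → ℝ) l
    rw [hlin a b x y hab]
    exact add_nonneg (mul_nonneg ha hx) (mul_nonneg hb hy)
  · refine isClosed_le continuous_const ?_
    exact (MvPolynomial.continuous_eval l).comp (by fun_prop)

theorem StS_compact : IsCompact (StS g) := by
  have hc : IsClosed (StS g) := by
    have : StS g = (⋂ j, {x | 0 ≤ eval x (homog (g j))}) ∩ ({x | 0 ≤ x 0} ∩ {x | ∑ i, x i ^ 2 = 1}) := by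
      ext x; simp [StS]
    rw [this]
    exact (isClosed_iInter fun j => isClosed_le continuous_const (MvPolynomial.continuous_eval _)).inter
      ((isClosed_le (by fun_prop) (by fun_prop)).inter (isClosed_eq (by fun_prop) (by fun_prop)))
  refine (isCompact_univ_pi fun _ => isCompact_Icc (a := (-1 : ℝ)) (b := 1)).of_isClosed_subset hc ?_
  intro x hx i _
  have := Finset.single_le_sum (f := fun i => x i ^ 2) (fun i _ => sq_nonneg _) (Finset.mem_univ i)
  rw [hx.2.2] at this
  exact abs_le.1 (sq_le_one_iff_abs_le_one _ |>.1 this)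

theorem exists_pos (hA : AssumpA g) :
    ∃ l : (Fin (n + 1) → ℝ) →L[ℝ] ℝ, ∀ x ∈ StS g, 0 < l x := by
  obtain ⟨h1, h2, h3⟩ := hA
  rw [h1] at h2 h3
  set K := convexHull ℝ (StC g) with hK
  have hsub : StC g ⊆ K := subset_convexHull _ _
  have hsm : ∀ c : ℝ, 0 ≤ c → ∀ x ∈ K, c • x ∈ K := by
    intro c hc x hx
    have : c • x ∈ c • K := Set.smul_mem_smul_set hx
    rw [hK, ← convexHull_smul] at this
    refine convexHull_mono ?_ this
    rintro _ ⟨y, hy, rfl⟩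
    exact StC_smul g hc hy
  have h0 : (0 : Fin (n + 1) → ℝ) ∈ K := by
    have : (0 : Fin (n + 1) → ℝ) ∈ K ∩ -K := by rw [h3]; rfl
    exact this.1
  have key : ∀ s ∈ StS g, ∃ l : (Fin (n + 1) → ℝ) →L[ℝ] ℝ, (∀ x ∈ K, 0 ≤ l x) ∧ 0 < l s := by
    intro s hs
    have hsK : s ∈ K := hsub ⟨hs.1, hs.2.1⟩
    have hns : -s ∉ K := by
      intro h
      have : s ∈ K ∩ -K := ⟨hsK, h⟩
      rw [h3] at this
      have h := hs.2.2
      rw [this] at h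
      simp at h
    obtain ⟨f, u, hu, hf⟩ := geometric_hahn_banach_point_closed (convex_convexHull ℝ _) h2 hns
    have hu0 := hf 0 h0
    rw [map_zero] at hu0
    refine ⟨f, fun x hx => ?_, ?_⟩
    · by_contra! hneg
      have := hf _ (hsm (u / f x) (div_nonneg_of_nonpos hu0.le hneg.le) x hx)
      rw [map_smul, smul_eq_mul, div_mul_cancel₀ _ hneg.ne] at this
      exact lt_irrefl _ this
    · rw [map_neg] at hu; linarith
  choose! l hl hls using key
  obtain ⟨t, ht, hcov⟩ := (StS_compact g).elim_nhds_subcover (fun s => {x | 0 < l s x})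
    (fun s hs => (isOpen_lt continuous_const (l s).continuous).mem_nhds (hls s hs))
  refine ⟨∑ s ∈ t, l s, fun x hx => ?_⟩
  obtain ⟨s, hs, hsx⟩ := Set.mem_iUnion₂.1 (hcov hx)
  rw [ContinuousLinearMap.sum_apply]
  exact Finset.sum_pos' (fun i hi => hl i (ht i hi) x (hsub ⟨hx.1, hx.2.1⟩)) ⟨s, hs, hsx⟩

theorem mem_of_forall_thetaB (hA : AssumpA g) (y : Fin n → ℝ) (hy : ∀ k, y ∈ thetaB k g) :
    y ∈ closure (convexHull ℝ (semiS g)) := by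
  by_contra hn
  obtain ⟨f, u, hu, hf⟩ := geometric_hahn_banach_point_closed (convex_convexHull ℝ _).closure
    isClosed_closure hn
  obtain ⟨l1, hl1⟩ := exists_pos g hA
  let l0 : (Fin (n + 1) → ℝ) →L[ℝ] ℝ :=
    f.comp (ContinuousLinearMap.pi fun i => ContinuousLinearMap.proj i.succ) - u • ContinuousLinearMap.proj 0
  have hl0 : ∀ z, l0 (Fin.cons 1 z : Fin (n + 1) → ℝ) = f z - u := by
    intro z
    have : (ContinuousLinearMap.pi fun i : Fin n => ContinuousLinearMap.proj (R := ℝ) (φ := fun _ : Fin (n + 1) => ℝ) i.succ)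
      (Fin.cons 1 z : Fin (n + 1) → ℝ) = z := by ext i; simp
    simp [l0, this]
  have hO : ∀ x ∈ StO g, 0 ≤ l0 x := by
    intro x hx
    obtain ⟨z, hz, e⟩ := StO_cons g hx
    rw [e, map_smul, hl0]
    exact mul_nonneg hx.2.le (by linarith [hf z (subset_closure (subset_convexHull _ _ hz))])
  have hC : ∀ x ∈ StC g, 0 ≤ l0 x := by
    rw [← hA.1]
    exact fun x hx => closure_minimal (t := {x | 0 ≤ l0 x}) hO (isClosed_le continuous_const l0.continuous) hx
  have hy0 : l0 (Fin.cons 1 y : Fin (n + 1) → ℝ) < 0 := by rw [hl0]; linarith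
  obtain ⟨δ, hδ, hδy⟩ : ∃ δ : ℝ, 0 < δ ∧ (l0 + δ • l1) (Fin.cons 1 y : Fin (n + 1) → ℝ) < 0 := by
    set a := l0 (Fin.cons 1 y : Fin (n + 1) → ℝ)
    set b := l1 (Fin.cons 1 y : Fin (n + 1) → ℝ) with hb
    have hb1 : 0 < |b| + 1 := by positivity
    refine ⟨-a / (2 * (|b| + 1)), by apply div_pos <;> linarith, ?_⟩
    change a + -a / (2 * (|b| + 1)) * b < 0
    have h1 : -a / (2 * (|b| + 1)) * b ≤ -a / (2 * (|b| + 1)) * (|b| + 1) :=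
      mul_le_mul_of_nonneg_left (by linarith [le_abs_self b]) (by apply div_nonneg <;> linarith)
    have h2 : -a / (2 * (|b| + 1)) * (|b| + 1) = -a / 2 := by field_simp
    linarith
  have hmem : linPoly (l0 + δ • l1 : (Fin (n + 1) → ℝ) →L[ℝ] ℝ).toLinearMap ∈ QFull (tGens g) := by
    refine putinar (QFull_gen (tGens g) (Sum.inr 2)) _ fun x hx => ?_
    rw [eval_linPoly]
    have hxS := (StS_gens g).2 hx
    have h1 := hC x ⟨hxS.1, hxS.2.1⟩
    have h2 := hl1 x hxS
    change 0 < l0 x + δ * l1 x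
    positivity
  obtain ⟨k, hk⟩ := QFull_QMod _ _ hmem
  have := hy k _ hk (linPoly_hom _)
  rw [eval_linPoly] at this
  exact absurd this (not_le.2 hδy)

theorem thetaB_closed (k : ℕ) : IsClosed (thetaB k g) := by
  have e : thetaB k g = ⋂ l ∈ {l | l ∈ QMod k (tGens g) ∧ l.IsHomogeneous 1},
      {x : Fin n → ℝ | 0 ≤ eval (Fin.cons 1 x) l} := by
    ext x; simp [thetaB]
  rw [e]
  refine isClosed_iInter fun l => isClosed_iInter fun _ => isClosed_le continuous_const ?_
  exact (MvPolynomial.continuous_eval l).comp (by fun_prop)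

theorem ball_compact (r : ℝ) (hr : 0 < r) : IsCompact {x : Fin n → ℝ | ∑ i, x i ^ 2 ≤ r ^ 2} := by
  refine (isCompact_univ_pi fun _ => isCompact_Icc (a := -r) (b := r)).of_isClosed_subset
    (isClosed_le (by fun_prop) (by fun_prop)) ?_
  intro x hx i _
  have := Finset.single_le_sum (f := fun i => x i ^ 2) (fun i _ => sq_nonneg _) (Finset.mem_univ i)
  exact abs_le.1 (abs_le_of_sq_le_sq (this.trans hx) hr.le)
end partC

/-- Theorem 3.14: under Assumption A, for every `ε > 0` and `r > 0` with
`closure (conv S) ∩ 𝐁ᵣ ≠ ∅`, there is `k` with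
`closure (conv S) ∩ 𝐁ᵣ ⊆ TH̃_k(G̃) ∩ 𝐁ᵣ ⊆ (closure (conv S) + ε𝐁₁) ∩ 𝐁ᵣ`
(Euclidean balls are described by `Σᵢ xᵢ² ≤ r²`). -/
theorem stmt9 (n m : ℕ) (g : Fin m → MvPolynomial (Fin n) ℝ) (hA : AssumpA g)
    (ε r : ℝ) (hε : 0 < ε) (hr : 0 < r)
    (hne : (closure (convexHull ℝ (semiS g)) ∩
      {x : Fin n → ℝ | ∑ i, x i ^ 2 ≤ r ^ 2}).Nonempty) :
    ∃ k : ℕ,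
      closure (convexHull ℝ (semiS g)) ∩ {x : Fin n → ℝ | ∑ i, x i ^ 2 ≤ r ^ 2} ⊆
        thetaB k g ∩ {x : Fin n → ℝ | ∑ i, x i ^ 2 ≤ r ^ 2} ∧
      thetaB k g ∩ {x : Fin n → ℝ | ∑ i, x i ^ 2 ≤ r ^ 2} ⊆
        (closure (convexHull ℝ (semiS g)) + ε • {x : Fin n → ℝ | ∑ i, x i ^ 2 ≤ 1}) ∩
          {x : Fin n → ℝ | ∑ i, x i ^ 2 ≤ r ^ 2} := by
  set B := {x : Fin n → ℝ | ∑ i, x i ^ 2 ≤ r ^ 2} with hB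
  set T := closure (convexHull ℝ (semiS g)) with hT
  by_contra! hcon
  have hU : IsOpen (T + {x : Fin n → ℝ | ∑ i, x i ^ 2 < ε ^ 2}) :=
    (isOpen_lt (by fun_prop) (by fun_prop)).add_left
  have hUsub : T + {x : Fin n → ℝ | ∑ i, x i ^ 2 < ε ^ 2} ⊆
      T + ε • {x : Fin n → ℝ | ∑ i, x i ^ 2 ≤ 1} := by
    refine Set.add_subset_add_left fun x hx => ?_
    rw [Set.mem_smul_set_iff_inv_smul_mem₀ hε.ne']
    have hx : ∑ i, x i ^ 2 < ε ^ 2 := hx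
    change ∑ i, (ε⁻¹ * x i) ^ 2 ≤ 1
    simp only [mul_pow, ← Finset.mul_sum]
    rw [inv_pow, inv_mul_le_iff₀ (by positivity)]
    linarith
  have hne' : ∀ k, ((thetaB k g ∩ B) \ (T + {x : Fin n → ℝ | ∑ i, x i ^ 2 < ε ^ 2})).Nonempty := by
    intro k
    by_contra hem
    rw [Set.not_nonempty_iff_eq_empty, Set.diff_eq_empty] at hem
    refine hcon k (Set.inter_subset_inter_left _ (thetaB_sup g k)) ?_
    exact fun x hx => ⟨hUsub (hem hx), hx.2⟩
  have hclosed : ∀ k, IsClosed ((thetaB k g ∩ B) \ (T + {x : Fin n → ℝ | ∑ i, x i ^ 2 < ε ^ 2})) :=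
    fun k => ((thetaB_closed g k).inter (ball_compact r hr).isClosed).sdiff hU
  obtain ⟨y, hy⟩ := IsCompact.nonempty_iInter_of_sequence_nonempty_isCompact_isClosed
    (fun k => (thetaB k g ∩ B) \ (T + {x : Fin n → ℝ | ∑ i, x i ^ 2 < ε ^ 2}))
    (fun k x hx => ⟨⟨fun l hl => hx.1.1 l (QMod_mono _ (Nat.le_succ k) hl), hx.1.2⟩, hx.2⟩) hne'
    ((ball_compact r hr).of_isClosed_subset (hclosed 0) fun x hx => hx.1.2) hclosed
  rw [Set.mem_iInter] at hy
  have hyT := mem_of_forall_thetaB g hA y fun k => (hy k).1.1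
  refine (hy 0).2 ⟨y, hyT, 0, ?_, add_zero y⟩
  change ∑ i : Fin n, (0 : ℝ) ^ 2 < ε ^ 2
  simp only [ne_eq, OfNat.ofNat_ne_zero, not_false_eq_true, zero_pow, Finset.sum_const_zero]
  positivity
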